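/- For every natural number n ≥ 1, g_0(n) < 2. -/

import Mathlib

open Finset

/-- λ = 2 + √3 -/
noncomputable def lam : ℝ := 2 + Real.sqrt 3

/-- A_k = (λ^k + λ^{-k}) / 2 -/
noncomputable def A (k : ℕ) : ℝ := (lam ^ k + lam⁻¹ ^ k) / 2

/-- B_k = (λ^k - λ^{-k}) / (2√3) -/
noncomputable def B (k : ℕ) : ℝ := (lam ^ k - lam⁻¹ ^ k) / (2 * Real.sqrt 3)

/-- φ(t) = (1 + t²)/(1 + t)² -/
noncomputable def phi (t : ℝ) : ℝ := (1 + t ^ 2) / (1 + t) ^ 2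

/-- g_k(n) = (1/B_n)·(A_{n-k}·Σ_{j<k}(A_{j+1}+A_j)φ(A_{j+1}/A_j)
              + A_k·Σ_{j<n-k}(A_{j+1}+A_j)φ(A_{j+1}/A_j)) -/
noncomputable def g (k n : ℕ) : ℝ :=
  (1 / B n) *
    (A (n - k) * ∑ j ∈ Finset.range k, (A (j + 1) + A j) * phi (A (j + 1) / A j)
      + A k * ∑ j ∈ Finset.range (n - k), (A (j + 1) + A j) * phi (A (j + 1) / A j))

theorem lam_pos : 0 < lam := by
  unfold lam
  positivity

theorem lam_inv : lam⁻¹ = 2 - Real.sqrt 3 := by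
  have h3 : Real.sqrt 3 ^ 2 = 3 := Real.sq_sqrt (by norm_num)
  refine inv_eq_of_mul_eq_one_right ?_
  unfold lam
  linear_combination -h3

theorem A_pos (k : ℕ) : 0 < A k := by
  have := lam_pos
  unfold A
  positivity

theorem A_zero : A 0 = 1 := by
  simp [A]

theorem B_zero : B 0 = 0 := by
  simp [B]

theorem A_succ (k : ℕ) : A (k + 1) = 2 * A k + 3 * B k := by
  have hs : Real.sqrt 3 ≠ 0 := by positivity
  have h3 : Real.sqrt 3 ^ 2 = 3 := Real.sq_sqrt (by norm_num)
  unfold A B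
  rw [lam_inv, pow_succ, pow_succ]
  unfold lam
  field_simp
  linear_combination ((2 + Real.sqrt 3) ^ k - (2 - Real.sqrt 3) ^ k) * h3

theorem B_succ (k : ℕ) : B (k + 1) = A k + 2 * B k := by
  have hs : Real.sqrt 3 ≠ 0 := by positivity
  unfold A B
  rw [lam_inv, pow_succ, pow_succ]
  unfold lam
  field_simp
  ring

theorem B_nonneg (k : ℕ) : 0 ≤ B k := by
  induction k with
  | zero => exact B_zero.ge
  | succ k ih =>
    rw [B_succ]
    linarith [A_pos k]

theorem A_sq_sub_three_mul_B_sq (k : ℕ) : A k ^ 2 - 3 * B k ^ 2 = 1 := by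
  induction k with
  | zero => simp [A_zero, B_zero]
  | succ k ih =>
    rw [A_succ, B_succ]
    linear_combination ih

theorem add_mul_phi_lt (j : ℕ) :
    (A (j + 1) + A j) * phi (A (j + 1) / A j) < 2 * (B (j + 1) - B j) := by
  have ha := A_pos j
  have ha' := A_pos (j + 1)
  have hb := B_nonneg j
  have hphi : (A (j + 1) + A j) * phi (A (j + 1) / A j)
      = (A (j + 1) ^ 2 + A j ^ 2) / (A (j + 1) + A j) := by
    unfold phi
    have : A j + A (j + 1) ≠ 0 := by positivity
    field_simp
    ring
  rw [hphi, div_lt_iff₀ (by positivity), A_succ, B_succ]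
  linarith [A_sq_sub_three_mul_B_sq j]

theorem sum_add_mul_phi_lt {n : ℕ} (hn : 1 ≤ n) :
    ∑ j ∈ Finset.range n, (A (j + 1) + A j) * phi (A (j + 1) / A j) < 2 * B n := by
  calc _ < ∑ j ∈ Finset.range n, 2 * (B (j + 1) - B j) :=
        Finset.sum_lt_sum_of_nonempty (Finset.nonempty_range_iff.mpr (by lia))
          fun j _ => add_mul_phi_lt j
    _ = 2 * B n := by rw [← Finset.mul_sum, Finset.sum_range_sub, B_zero, sub_zero]

theorem g_zero_lt_two (n : ℕ) (hn : 1 ≤ n) : g 0 n < 2 := by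
  have hB : 0 < B n := by
    obtain ⟨m, rfl⟩ := Nat.exists_eq_add_of_le' hn
    rw [B_succ]
    linarith [A_pos m, B_nonneg m]
  have hg : g 0 n
      = (∑ j ∈ Finset.range n, (A (j + 1) + A j) * phi (A (j + 1) / A j)) / B n := by
    simp [g, A_zero, div_eq_inv_mul]
  rw [hg, div_lt_iff₀ hB]
  exact sum_add_mul_phi_lt hn
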